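/- Let n ≥ 3, d ≥ 2, and suppose n = p + 2q + ⋯ + t s is partitioned into p singletons, q pairs, …, s blocks of size t. With a_1 = 2(d−1)/d, a_2 = 4(d²−1)/d², and a_t = 2^t(1 − (C_t)/((t−2)d^{t+1})) for t ≥ 3 where C_t = (t d^{t−1} − t d + (t−2)d) arising from equal dimensions, any state ρ on (ℂ^d)^{⊗n} separable with respect to this partition satisfies ‖T^{(12⋯n)}‖² ≤ a_1^p a_2^q ⋯ a_t^s. -/

import Mathlib

open Matrix BigOperators

/-- The Kronecker (tensor) product of a finite family of square matrices, given entrywise. -/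
def famKron {ι : Type*} [Fintype ι] {dims : ι → ℕ}
    (M : ∀ k, Matrix (Fin (dims k)) (Fin (dims k)) ℂ) :
    Matrix (∀ k, Fin (dims k)) (∀ k, Fin (dims k)) ℂ :=
  fun a b => ∏ k, M k (a k) (b k)

/-- The upper bound for the squared correlation-tensor norm of a block of `t` qudits of
local dimension `d`: a₁ = 2(d−1)/d, a₂ = 4(d²−1)/d², and
a_t = 2^t((t−2)d^t − t d^{t−2} + 2)/((t−2)d^t) for t ≥ 3. -/
noncomputable def blockBound (d : ℕ) : ℕ → ℝ := fun t =>
  if t = 1 then 2 * ((d : ℝ) - 1) / (d : ℝ)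
  else if t = 2 then 4 * ((d : ℝ) ^ 2 - 1) / (d : ℝ) ^ 2
  else 2 ^ t * (((t : ℝ) - 2) * (d : ℝ) ^ t - (t : ℝ) * (d : ℝ) ^ (t - 2) + 2)
      / (((t : ℝ) - 2) * (d : ℝ) ^ t)

theorem sum_norm_sq_of_complete {A X : Type*} [Fintype A] [Fintype X] [DecidableEq X]
    (u : A → X → ℂ)
    (hu : ∀ x x', ∑ a, u a x * star (u a x') = if x = x' then 1 else 0) (F : X → ℂ) :
    ∑ a, ‖∑ x, F x * u a x‖ ^ 2 = ∑ x, ‖F x‖ ^ 2 := by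
  have key : ∑ a, (∑ x, F x * u a x) * star (∑ x, F x * u a x) = ∑ x, F x * star (F x) := by
    calc _ = ∑ x, ∑ x', F x * star (F x') * ∑ a, u a x * star (u a x') := by
          simp_rw [star_sum, Finset.sum_mul_sum, Finset.mul_sum]
          rw [Finset.sum_comm]
          refine Finset.sum_congr rfl fun x _ => ?_
          rw [Finset.sum_comm]
          refine Finset.sum_congr rfl fun x' _ => Finset.sum_congr rfl fun a _ => ?_
          rw [star_mul']
          ring
      _ = _ := by simp only [hu]; simp
  simp only [← starRingEnd_apply, Complex.mul_conj'] at key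
  exact_mod_cast key

theorem sum_norm_sq_partial_contraction {A X Y : Type*} [Fintype A] [Fintype X] [Fintype Y]
    [DecidableEq X] [DecidableEq Y] (u : A → X × X → ℂ)
    (hu : ∀ x x', ∑ a, u a x * star (u a x') = if x = x' then 1 else 0)
    (v : Y → Y → ℂ) (c : ℂ) (hv : ∀ y y', v y y' = if y = y' then c else 0)
    (ψ : X → Y → ℂ) :
    ∑ a, ‖∑ x, ∑ y, ∑ x', ∑ y', ψ x y * star (ψ x' y') * (u a (x', x) * v y' y)‖ ^ 2
      = ‖c‖ ^ 2 * ∑ x, ∑ x', ‖∑ y, ψ x y * star (ψ x' y)‖ ^ 2 := by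
  have h := sum_norm_sq_of_complete u hu (fun q => c * ∑ y, ψ q.2 y * star (ψ q.1 y))
  simp only [Fintype.sum_prod_type, norm_mul, mul_pow, ← Finset.mul_sum] at h
  rw [Finset.sum_comm (f := fun x x' => ‖∑ y, ψ x y * star (ψ x' y)‖ ^ 2), ← h]
  refine Finset.sum_congr rfl fun a _ => ?_
  congr 2
  simp only [hv, mul_ite, mul_zero, Finset.sum_ite_eq', Finset.mem_univ, if_true]
  rw [Finset.sum_comm (f := fun x' x => (c * ∑ y, ψ x y * star (ψ x' y)) * u a (x', x))]
  refine Finset.sum_congr rfl fun x _ => ?_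
  rw [Finset.sum_comm]
  refine Finset.sum_congr rfl fun x' _ => ?_
  rw [Finset.mul_sum, Finset.sum_mul]
  exact Finset.sum_congr rfl fun y _ => by ring

theorem sum_norm_sq_reduced_comm {X Y : Type*} [Fintype X] [Fintype Y] (ψ : X → Y → ℂ) :
    ∑ x, ∑ x', ‖∑ y, ψ x y * star (ψ x' y)‖ ^ 2
      = ∑ y, ∑ y', ‖∑ x, ψ x y * star (ψ x y')‖ ^ 2 := by
  have key : ∑ x, ∑ x', (∑ y, ψ x y * star (ψ x' y)) * star (∑ y, ψ x y * star (ψ x' y))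
      = ∑ y, ∑ y', (∑ x, ψ x y * star (ψ x y')) * star (∑ x, ψ x y * star (ψ x y')) := by
    simp_rw [star_sum, Finset.sum_mul_sum]
    simp only [← Fintype.sum_prod_type']
    let e : X × X × Y × Y ≃ Y × Y × X × X :=
      ⟨fun q => (q.2.2.1, q.2.2.2, q.1, q.2.1), fun q => (q.2.2.1, q.2.2.2, q.1, q.2.1),
        fun _ => rfl, fun _ => rfl⟩
    refine Fintype.sum_equiv e _ _ fun q => ?_
    simp only [e, Equiv.coe_fn_mk, star_mul', star_star]
    ring
  simp only [← starRingEnd_apply, Complex.mul_conj'] at key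
  simp only [← starRingEnd_apply]
  exact_mod_cast key

/-- The expectation value of a product operator `⨂ M k` in the pure state `ψ`. -/
noncomputable def correlation {κ D : Type*} [Fintype κ] [Fintype D] [DecidableEq κ]
    (ψ : (κ → D) → ℂ) (M : κ → Matrix D D ℂ) : ℂ :=
  ∑ x, ∑ y, ψ x * star (ψ y) * ∏ k, M k (y k) (x k)

theorem prod_complete {κ D A : Type*} [Fintype κ] [DecidableEq κ] [Fintype A] [DecidableEq D]
    (g : A → Matrix D D ℂ)
    (hg : ∀ q q' : D × D, ∑ a, g a q.1 q.2 * star (g a q'.1 q'.2) = if q = q' then 1 else 0)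
    (q q' : (κ → D) × (κ → D)) :
    ∑ a : κ → A, (∏ k, g (a k) (q.1 k) (q.2 k)) * star (∏ k, g (a k) (q'.1 k) (q'.2 k))
      = if q = q' then 1 else 0 := by
  simp_rw [star_prod, ← Finset.prod_mul_distrib]
  have h := Finset.prod_univ_sum (fun _ : κ => (Finset.univ : Finset A))
    (fun k a => g a (q.1 k) (q.2 k) * star (g a (q'.1 k) (q'.2 k)))
  rw [Fintype.piFinset_univ] at h
  rw [← h]
  have h2 : ∀ k, ∑ a, g a (q.1 k) (q.2 k) * star (g a (q'.1 k) (q'.2 k))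
      = if (q.1 k = q'.1 k ∧ q.2 k = q'.2 k) then 1 else 0 := fun k => by
    simpa using hg (q.1 k, q.2 k) (q'.1 k, q'.2 k)
  simp_rw [h2, Finset.prod_ite_zero]
  simp [Prod.ext_iff, funext_iff, forall_and]

theorem sum_norm_sq_correlation {κ D A : Type*} [Fintype κ] [DecidableEq κ] [Fintype A]
    [Fintype D] [DecidableEq D] (g : A → Matrix D D ℂ)
    (hg : ∀ q q' : D × D, ∑ a, g a q.1 q.2 * star (g a q'.1 q'.2) = if q = q' then 1 else 0)
    (ψ : (κ → D) → ℂ) :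
    ∑ a : κ → A, ‖correlation ψ fun k => g (a k)‖ ^ 2 = (∑ x, ‖ψ x‖ ^ 2) ^ 2 := by
  have h := sum_norm_sq_of_complete
    (fun (a : κ → A) (q : (κ → D) × (κ → D)) => ∏ k, g (a k) (q.2 k) (q.1 k))
    (fun q q' => by simpa [Prod.ext_iff, and_comm] using prod_complete g hg q.swap q'.swap)
    (fun q => ψ q.1 * star (ψ q.2))
  simp only [Fintype.sum_prod_type] at h
  simp only [correlation, h]
  simp [mul_pow, sq (∑ x, ‖ψ x‖ ^ 2), Finset.sum_mul_sum]

theorem correlation_split {κ D : Type*} [Fintype κ] [DecidableEq κ] [Fintype D]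
    (ψ : (κ → D) → ℂ) (M : κ → Matrix D D ℂ) (k : κ) :
    correlation ψ M = ∑ x, ∑ y, ∑ x', ∑ y',
      ψ ((Equiv.funSplitAt k D).symm (x, y)) * star (ψ ((Equiv.funSplitAt k D).symm (x', y'))) *
        (M k x' x * ∏ j : {j // j ≠ k}, M j (y' j) (y j)) := by
  rw [correlation, ← (Equiv.funSplitAt k D).symm.sum_comp, Fintype.sum_prod_type]
  refine Finset.sum_congr rfl fun x _ => Finset.sum_congr rfl fun y _ => ?_
  rw [← (Equiv.funSplitAt k D).symm.sum_comp, Fintype.sum_prod_type]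
  refine Finset.sum_congr rfl fun x' _ => Finset.sum_congr rfl fun y' _ => ?_
  rw [Fintype.prod_eq_mul_prod_subtype_ne _ k]
  congr 2
  · simp
  · refine Finset.prod_congr rfl fun j _ => ?_
    simp [j.2]

theorem prod_one_apply {κ D : Type*} [Fintype κ] [Fintype D] [DecidableEq D] (c : ℂ)
    (y y' : κ → D) :
    ∏ k, (c • (1 : Matrix D D ℂ)) (y k) (y' k) = if y = y' then c ^ Fintype.card κ else 0 := by
  simp only [Matrix.smul_apply, Matrix.one_apply, smul_eq_mul, mul_ite, mul_one, mul_zero,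
    Finset.prod_ite_zero]
  simp [funext_iff]

theorem sum_correlation_vanishing_at {κ D J : Type*} [Fintype κ] [DecidableEq κ] [Fintype J]
    [Fintype D] [DecidableEq D] (g : Option J → Matrix D D ℂ)
    (hg : ∀ q q' : D × D, ∑ a, g a q.1 q.2 * star (g a q'.1 q'.2) = if q = q' then 1 else 0)
    (c : ℂ) (hc : g none = c • 1) (ψ : (κ → D) → ℂ) (k : κ) :
    ‖c ^ (Fintype.card κ - 1)‖ ^ 2 *
        ∑ b : {j // j ≠ k} → Option J,
          ‖correlation ψ fun j => g ((Equiv.funSplitAt k (Option J)).symm (none, b) j)‖ ^ 2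
      = ‖c‖ ^ 2 * ∑ o : Option J,
          ‖correlation ψ fun j => g (Function.update (fun _ => none) k o j)‖ ^ 2 := by
  have h1 := sum_norm_sq_partial_contraction
    (fun (a : {j // j ≠ k} → Option J) (q : ({j // j ≠ k} → D) × ({j // j ≠ k} → D)) =>
      ∏ j, g (a j) (q.1 j) (q.2 j)) (prod_complete g hg) (g none) c
    (fun y y' => by simp [hc, Matrix.one_apply])
    (fun y x => ψ ((Equiv.funSplitAt k D).symm (x, y)))
  have h2 := sum_norm_sq_partial_contraction (fun a q => g a q.1 q.2) hg
    (fun y y' : {j // j ≠ k} → D => ∏ j, g none (y j) (y' j)) (c ^ Fintype.card {j // j ≠ k})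
    (fun y y' => by rw [hc]; exact prod_one_apply c y y')
    (fun x y => ψ ((Equiv.funSplitAt k D).symm (x, y)))
  rw [sum_norm_sq_reduced_comm] at h1
  generalize (∑ x, ∑ x', ‖∑ y, ψ ((Equiv.funSplitAt k D).symm (x, y)) *
    star (ψ ((Equiv.funSplitAt k D).symm (x', y)))‖ ^ 2) = P at h1 h2
  have h1' : ∑ b : {j // j ≠ k} → Option J,
      ‖correlation ψ fun j => g ((Equiv.funSplitAt k (Option J)).symm (none, b) j)‖ ^ 2
        = ‖c‖ ^ 2 * P := by
    refine Eq.trans (Finset.sum_congr rfl fun b _ => ?_) h1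
    congr 2
    rw [correlation_split _ _ k, Finset.sum_comm]
    refine Finset.sum_congr rfl fun y _ => Finset.sum_congr rfl fun x _ => ?_
    rw [Finset.sum_comm]
    refine Finset.sum_congr rfl fun y' _ => Finset.sum_congr rfl fun x' _ => ?_
    rw [mul_comm (∏ j, _) (g none _ _)]
    congr 2
    · simp
    · exact Finset.prod_congr rfl fun j _ => by simp [j.2]
  have h2' : ∑ o : Option J,
      ‖correlation ψ fun j => g (Function.update (fun _ => none) k o j)‖ ^ 2
        = ‖c ^ Fintype.card {j // j ≠ k}‖ ^ 2 * P := by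
    refine Eq.trans (Finset.sum_congr rfl fun b _ => ?_) h2
    congr 2
    rw [correlation_split _ _ k]
    refine Finset.sum_congr rfl fun x _ => Finset.sum_congr rfl fun y _ =>
      Finset.sum_congr rfl fun x' _ => Finset.sum_congr rfl fun y' _ => ?_
    congr 2
    · simp
    · exact Finset.prod_congr rfl fun j _ => by simp [j.2]
  have hcard : Fintype.card {j // j ≠ k} = Fintype.card κ - 1 := by simp
  rw [h1', h2', hcard]
  ring

/-- The weight counting of the block bound: `f` is nonnegative on strings over `Option J`, and
`hk` is equality of the purities of a single site and its complement. -/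
theorem fullWeight_le {κ J : Type*} [Fintype κ] [DecidableEq κ] [Fintype J] [DecidableEq J]
    (f : (κ → Option J) → ℝ) (hf : ∀ a, 0 ≤ f a) (hsum : ∑ a, f a = 1) (hκ : 2 < Fintype.card κ)
    (r : ℝ) (hr : 1 ≤ r)
    (hk : ∀ k, ∑ b : {j // j ≠ k} → Option J, f ((Equiv.funSplitAt k (Option J)).symm (none, b))
      = r * ∑ o : Option J, f (Function.update (fun _ => none) k o)) :
    ((Fintype.card κ : ℝ) - 2) * ∑ i : κ → J, f (fun k => some (i k))
      ≤ ((Fintype.card κ : ℝ) - 2) + 2 * f (fun _ => none)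
        - r * Fintype.card κ * f (fun _ => none) := by
  set t : ℝ := (Fintype.card κ : ℝ) with ht
  let Z : (κ → Option J) → ℕ := fun a => (Finset.univ.filter fun k => a k = none).card
  have hZ : ∑ k, ∑ b : {j // j ≠ k} → Option J,
      f ((Equiv.funSplitAt k (Option J)).symm (none, b)) = ∑ a, (Z a : ℝ) * f a := by
    have : ∀ k, ∑ b : {j // j ≠ k} → Option J,
        f ((Equiv.funSplitAt k (Option J)).symm (none, b))
        = ∑ a, if a k = none then f a else 0 := fun k => by
      rw [← (Equiv.funSplitAt k (Option J)).symm.sum_comp, Fintype.sum_prod_type,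
        Finset.sum_eq_single none]
      · simp
      · intro o _ ho
        simp [ho]
      · simp
    simp_rw [this]
    rw [Finset.sum_comm]
    refine Finset.sum_congr rfl fun a _ => ?_
    rw [← Finset.sum_filter, Finset.sum_const, nsmul_eq_mul]
  have hW : ∑ k, ∑ j : J, f (Function.update (fun _ => none) k (some j))
      = ∑ a, (∑ k, ∑ j : J,
          if Function.update (fun _ => none) k (some j) = a then 1 else 0) * f a := by
    simp_rw [Finset.sum_mul]
    conv_rhs => rw [Finset.sum_comm]
    refine Finset.sum_congr rfl fun k _ => ?_
    conv_rhs => rw [Finset.sum_comm]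
    refine Finset.sum_congr rfl fun j _ => ?_
    simp
  have hF : ∑ i : κ → J, f (fun k => some (i k))
      = ∑ a, (if Z a = 0 then 1 else 0) * f a := by
    simp only [ite_mul, one_mul, zero_mul]
    rw [← Finset.sum_filter]
    refine Finset.sum_bij (fun i _ k => some (i k)) ?_ ?_ ?_ ?_
    · simp [Z]
    · intro i _ i' _ h
      funext k
      simpa using congrFun h k
    · intro a ha
      simp only [Z, Finset.mem_filter, Finset.mem_univ, true_and, Finset.card_eq_zero,
        Finset.filter_eq_empty_iff, forall_const] at ha
      choose i hi using fun k => Option.ne_none_iff_exists'.1 (ha (x := k))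
      exact ⟨i, Finset.mem_univ _, (funext hi).symm⟩
    · simp
  have h0 : f (fun _ => none) = ∑ a, (if (fun _ => none) = a then 1 else 0) * f a := by simp
  have hpt : ∀ a, (t - 2) * (if Z a = 0 then 1 else 0) + Z a ≤ (t - 2)
      + 2 * (if (fun _ => none) = a then 1 else 0)
      + ∑ k, ∑ j : J, if Function.update (fun _ => none) k (some j) = a then (1 : ℝ) else 0 := by
    intro a
    have hN : 0 ≤ ∑ k, ∑ j : J,
        if Function.update (fun _ => none) k (some j) = a then (1 : ℝ) else 0 :=
      Finset.sum_nonneg fun _ _ => Finset.sum_nonneg fun _ _ => by split_ifs <;> norm_num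
    have hcompl := Finset.card_filter_add_card_filter_not
      (s := (Finset.univ : Finset κ)) (fun k => a k = none)
    rw [Finset.card_univ] at hcompl
    have ht2 : (2 : ℝ) < t := by rw [ht]; exact_mod_cast hκ
    by_cases hz : Z a = 0
    · have : (0 : ℝ) ≤ if (fun _ => none) = a then 1 else 0 := by split_ifs <;> norm_num
      simp only [hz, if_true, Nat.cast_zero]
      linarith
    · simp only [hz, if_false]
      rcases Nat.lt_or_ge 1 (Finset.univ.filter fun k => ¬ a k = none).card with h | h
      · have : (Z a : ℝ) + 2 ≤ t := by
          rw [ht]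
          exact_mod_cast (by simp only [Z]; omega : Z a + 2 ≤ Fintype.card κ)
        have : (0 : ℝ) ≤ if (fun _ => none) = a then 1 else 0 := by split_ifs <;> norm_num
        linarith
      · rcases Nat.lt_or_ge 0 (Finset.univ.filter fun k => ¬ a k = none).card with h' | h'
        · obtain ⟨k, hk⟩ := Finset.card_eq_one.1 (le_antisymm h h')
          have hk1 : a k ≠ none := by
            have : k ∈ Finset.univ.filter fun k => ¬ a k = none := by rw [hk]; simp
            simpa using this
          obtain ⟨j, hj⟩ := Option.ne_none_iff_exists'.1 hk1
          have hak : Function.update (fun _ => none) k (some j) = a := by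
            funext l
            by_cases hl : l = k
            · subst hl
              simp [hj]
            · rw [Function.update_of_ne hl]
              by_contra hne
              have : l ∈ Finset.univ.filter fun k => ¬ a k = none := by
                simpa using fun h => hne h.symm
              rw [hk] at this
              exact hl (by simpa using this)
          have hN1 : (1 : ℝ) ≤ ∑ k, ∑ j : J,
              if Function.update (fun _ => none) k (some j) = a then (1 : ℝ) else 0 := by
            calc (1 : ℝ) = if Function.update (fun _ => none) k (some j) = a then 1 else 0 := by
                  rw [if_pos hak]
              _ ≤ ∑ j : J, if Function.update (fun _ => none) k (some j) = a then (1 : ℝ) else 0 :=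
                  Finset.single_le_sum (f := fun j : J =>
                    if Function.update (fun _ => none) k (some j) = a then (1 : ℝ) else 0)
                    (fun _ _ => by split_ifs <;> norm_num) (Finset.mem_univ j)
              _ ≤ _ := Finset.single_le_sum (f := fun k => ∑ j : J,
                    if Function.update (fun _ => none) k (some j) = a then (1 : ℝ) else 0)
                    (fun _ _ => Finset.sum_nonneg fun _ _ => by split_ifs <;> norm_num)
                    (Finset.mem_univ k)
          have : (Z a : ℝ) + 1 ≤ t := by
            rw [ht]
            exact_mod_cast (by simp only [Z]; omega : Z a + 1 ≤ Fintype.card κ)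
          have : (0 : ℝ) ≤ if (fun _ => none) = a then 1 else 0 := by split_ifs <;> norm_num
          linarith
        · have ha : (fun _ => none) = a := by
            funext l
            have := Finset.card_eq_zero.1 (Nat.le_zero.1 h')
            rw [Finset.filter_eq_empty_iff] at this
            simpa [eq_comm] using this (Finset.mem_univ l)
          have : (Z a : ℝ) ≤ t := by
            rw [ht]
            exact_mod_cast (by simp only [Z]; omega : Z a ≤ Fintype.card κ)
          rw [if_pos ha]
          linarith
  have hmain := Finset.sum_le_sum fun a (_ : a ∈ Finset.univ) =>
    mul_le_mul_of_nonneg_right (hpt a) (hf a)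
  simp only [add_mul, Finset.sum_add_distrib, mul_assoc, ← Finset.mul_sum] at hmain
  rw [← hF, ← h0, ← hW, ← hZ, hsum] at hmain
  simp_rw [hk, ← Finset.mul_sum, Fintype.sum_option, Finset.sum_add_distrib] at hmain
  simp only [Function.update_eq_self, Finset.sum_const, Finset.card_univ, nsmul_eq_mul] at hmain
  have hW0 : 0 ≤ ∑ k, ∑ j : J, f (Function.update (fun _ => none) k (some j)) :=
    Finset.sum_nonneg fun _ _ => Finset.sum_nonneg fun _ _ => hf _
  have := mul_le_mul_of_nonneg_right hr hW0
  rw [← ht] at hmain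
  linarith

/-- The orthonormal operator basis obtained by normalising the identity and the generators. -/
noncomputable def normalizedBasis {d : ℕ} {J : Type*} (lam : J → Matrix (Fin d) (Fin d) ℂ) :
    Option J → Matrix (Fin d) (Fin d) ℂ
  | none => (((√(d : ℝ))⁻¹ : ℝ) : ℂ) • 1
  | some i => (((√2)⁻¹ : ℝ) : ℂ) • lam i

theorem normalizedBasis_complete {d : ℕ} (hd : 1 ≤ d)
    (lam : Fin (d ^ 2 - 1) → Matrix (Fin d) (Fin d) ℂ)
    (hherm : ∀ i, (lam i).IsHermitian) (htr0 : ∀ i, (lam i).trace = 0)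
    (horth : ∀ i j, (lam i * lam j).trace = if i = j then 2 else 0) (q q' : Fin d × Fin d) :
    ∑ a, normalizedBasis lam a q.1 q.2 * star (normalizedBasis lam a q'.1 q'.2)
      = if q = q' then 1 else 0 := by
  set g := normalizedBasis lam with hgdef
  have hgh : ∀ a, (g a).IsHermitian := by
    rintro (_ | i) <;>
      simp [hgdef, normalizedBasis, Matrix.IsHermitian, Matrix.conjTranspose_smul, (hherm _).eq]
  have hsq : ∀ x : ℝ, 0 < x → (((√x)⁻¹ : ℝ) : ℂ) * (((√x)⁻¹ : ℝ) : ℂ) * (x : ℂ) = 1 := by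
    intro x hx
    rw [← Complex.ofReal_mul, ← mul_inv, Real.mul_self_sqrt hx.le, ← Complex.ofReal_mul,
      inv_mul_cancel₀ hx.ne', Complex.ofReal_one]
  have hgo : ∀ a b, (g a * g b).trace = if a = b then 1 else 0 := by
    rintro (_ | i) (_ | j)
    · have := hsq d (by exact_mod_cast hd)
      simp only [hgdef, normalizedBasis, Matrix.smul_mul, Matrix.mul_smul, Matrix.trace_smul,
        smul_eq_mul, one_mul, Matrix.trace_one, Fintype.card_fin, if_true, ← mul_assoc]
      simpa using this
    · simp [hgdef, normalizedBasis, htr0]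
    · simp [hgdef, normalizedBasis, htr0]
    · have := hsq 2 (by norm_num)
      simp only [hgdef, normalizedBasis, Matrix.smul_mul, Matrix.mul_smul, Matrix.trace_smul,
        smul_eq_mul, horth, Option.some.injEq, ← mul_assoc]
      split_ifs
      · simpa using this
      · simp
  let U : Matrix (Option (Fin (d ^ 2 - 1))) (Fin d × Fin d) ℂ := fun a q => star (g a q.1 q.2)
  let V : Matrix (Fin d × Fin d) (Option (Fin (d ^ 2 - 1))) ℂ := fun q a => g a q.1 q.2
  have hUV : U * V = 1 := by
    ext a b
    rw [Matrix.one_apply, ← hgo a b, Matrix.mul_apply, Matrix.trace, Fintype.sum_prod_type,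
      Finset.sum_comm]
    refine Finset.sum_congr rfl fun i _ => ?_
    rw [Matrix.diag_apply, Matrix.mul_apply]
    refine Finset.sum_congr rfl fun j _ => ?_
    simp only [U, V]
    rw [(hgh a).apply]
  have hVU : V * U = 1 := by
    refine (Matrix.mul_eq_one_comm_of_card_eq _ _ ℂ ?_).1 hUV
    have : 1 ≤ d ^ 2 := Nat.one_le_pow _ _ hd
    simp only [Fintype.card_option, Fintype.card_fin, Fintype.card_prod]
    rw [Nat.sub_add_cancel this, sq]
  have h := congrFun (congrFun hVU q) q'
  rwa [Matrix.mul_apply, Matrix.one_apply] at h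

theorem correlation_smul {κ D : Type*} [Fintype κ] [Fintype D] [DecidableEq κ]
    (ψ : (κ → D) → ℂ) (c : ℂ) (M : κ → Matrix D D ℂ) :
    correlation ψ (fun k => c • M k) = c ^ Fintype.card κ * correlation ψ M := by
  simp only [correlation, Finset.mul_sum, Matrix.smul_apply, smul_eq_mul, Finset.prod_mul_distrib,
    Finset.prod_const, Finset.card_univ]
  exact Finset.sum_congr rfl fun x _ => Finset.sum_congr rfl fun y _ => by ring

theorem correlation_one {κ D : Type*} [Fintype κ] [Fintype D] [DecidableEq κ] [DecidableEq D]
    (ψ : (κ → D) → ℂ) :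
    correlation ψ (fun _ => 1) = ((∑ x, ‖ψ x‖ ^ 2 : ℝ) : ℂ) := by
  have h := fun x y : κ → D => prod_one_apply 1 y x
  simp only [one_smul, one_pow] at h
  simp only [correlation, h, mul_ite, mul_one, mul_zero, Finset.sum_ite_eq', Finset.mem_univ,
    if_true, ← starRingEnd_apply, Complex.mul_conj']
  push_cast
  rfl

/-- The single-block bound for pure states. -/
theorem sum_norm_sq_correlation_le_blockBound {κ : Type*} [Fintype κ] [DecidableEq κ] [Nonempty κ]
    {d : ℕ} (hd : 1 ≤ d) (lam : Fin (d ^ 2 - 1) → Matrix (Fin d) (Fin d) ℂ)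
    (hherm : ∀ i, (lam i).IsHermitian) (htr0 : ∀ i, (lam i).trace = 0)
    (horth : ∀ i j, (lam i * lam j).trace = if i = j then 2 else 0)
    (ψ : (κ → Fin d) → ℂ) (hψ : ∑ x, ‖ψ x‖ ^ 2 = 1) :
    ∑ i : κ → Fin (d ^ 2 - 1), ‖correlation ψ fun k => lam (i k)‖ ^ 2
      ≤ blockBound d (Fintype.card κ) := by
  have hg := normalizedBasis_complete hd lam hherm htr0 horth
  set g := normalizedBasis lam with hgdef
  set t := Fintype.card κ with ht
  have ht0 : 0 < t := Fintype.card_pos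
  have hd0 : (0 : ℝ) < d := by exact_mod_cast hd
  let f : (κ → Option (Fin (d ^ 2 - 1))) → ℝ := fun a => ‖correlation ψ fun k => g (a k)‖ ^ 2
  have hf : ∀ a, 0 ≤ f a := fun a => sq_nonneg _
  have hsum : ∑ a, f a = 1 := by simp [f, sum_norm_sq_correlation g hg ψ, hψ]
  have hnormsq : ∀ x : ℝ, 0 ≤ x → ∀ k : ℕ, ‖((((√x)⁻¹ : ℝ) : ℂ)) ^ k‖ ^ 2 = (x ^ k)⁻¹ := by
    intro x hx k
    rw [norm_pow, Complex.norm_real, Real.norm_of_nonneg (by positivity), ← pow_mul, mul_comm,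
      pow_mul, inv_pow, Real.sq_sqrt hx, inv_pow]
  have h0 : f (fun _ => none) = ((d : ℝ) ^ t)⁻¹ := by
    have := correlation_smul ψ ((((√(d : ℝ))⁻¹ : ℝ) : ℂ)) (fun _ => 1)
    simp only [f, hgdef, normalizedBasis, this, correlation_one, hψ]
    rw [norm_mul, mul_pow, hnormsq _ hd0.le]
    simp [ht]
  have hW : ∑ i : κ → Fin (d ^ 2 - 1), ‖correlation ψ fun k => lam (i k)‖ ^ 2
      = 2 ^ t * ∑ i : κ → Fin (d ^ 2 - 1), f (fun k => some (i k)) := by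
    rw [Finset.mul_sum]
    refine Finset.sum_congr rfl fun i _ => ?_
    have := correlation_smul ψ ((((√2)⁻¹ : ℝ) : ℂ)) (fun k => lam (i k))
    simp only [f, hgdef, normalizedBasis, this]
    rw [norm_mul, mul_pow, hnormsq _ (by norm_num), ← mul_assoc, mul_inv_cancel₀ (by positivity),
      one_mul]
  rw [hW]
  rcases Nat.lt_or_ge 2 t with h3 | h3
  · have hk := fullWeight_le f hf hsum h3 ((d : ℝ) ^ (t - 2))
      (one_le_pow₀ (by exact_mod_cast hd)) fun k => by
        have h := sum_correlation_vanishing_at g hg _ rfl ψ k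
        have h1 := hnormsq d hd0.le 1
        rw [pow_one, pow_one] at h1
        rw [hnormsq d hd0.le, h1, ← ht] at h
        obtain ⟨s, hs⟩ : ∃ s, t = s + 2 := ⟨t - 2, by omega⟩
        rw [hs] at h ⊢
        simp only [Nat.add_sub_cancel, show s + 2 - 1 = s + 1 by omega] at h ⊢
        simp only [f]
        rw [pow_succ, mul_inv] at h
        field_simp at h
        linarith
    rw [h0, ← ht] at hk
    have ht2 : (0 : ℝ) < t - 2 := by
      have : (2 : ℝ) < t := by exact_mod_cast h3
      linarith
    rw [blockBound, if_neg (by omega), if_neg (by omega), mul_div_assoc]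
    refine mul_le_mul_of_nonneg_left ?_ (by positivity)
    rw [le_div_iff₀ (by positivity)]
    have hdt : (0 : ℝ) < (d : ℝ) ^ t := by positivity
    have := mul_le_mul_of_nonneg_right hk hdt.le
    have e : ((d : ℝ) ^ t)⁻¹ * (d : ℝ) ^ t = 1 := inv_mul_cancel₀ hdt.ne'
    linear_combination this + (2 - (d : ℝ) ^ (t - 2) * t) * e
  · have hle : ∑ i : κ → Fin (d ^ 2 - 1), f (fun k => some (i k)) + f (fun _ => none) ≤ 1 := by
      rw [← hsum, add_comm]
      have hinj : Function.Injective
          (fun (i : κ → Fin (d ^ 2 - 1)) k => (some (i k) : Option (Fin (d ^ 2 - 1)))) :=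
        fun i i' h => funext fun k => by simpa using congrFun h k
      have hnot : (fun _ : κ => (none : Option (Fin (d ^ 2 - 1)))) ∉
          Finset.univ.map ⟨_, hinj⟩ := by
        obtain ⟨k⟩ := ‹Nonempty κ›
        simp only [Finset.mem_map, Finset.mem_univ, true_and, not_exists]
        intro i h
        simpa using congrFun h k
      calc _ = ∑ a ∈ Finset.cons _ (Finset.univ.map ⟨_, hinj⟩) hnot, f a := by
            rw [Finset.sum_cons, Finset.sum_map]
            rfl
        _ ≤ _ := Finset.sum_le_sum_of_subset_of_nonneg (Finset.subset_univ _) fun a _ _ => hf a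
    rw [h0] at hle
    have hb : blockBound d t = 2 ^ t * (1 - ((d : ℝ) ^ t)⁻¹) := by
      interval_cases t
      · simp [blockBound]
        field_simp
      · simp [blockBound]
        field_simp
        ring
    rw [hb]
    exact mul_le_mul_of_nonneg_left (by linarith) (by positivity)

theorem trace_vecMulVec_mul_famKron {n d : ℕ} (ψ : (Fin n → Fin d) → ℂ)
    (M : Fin n → Matrix (Fin d) (Fin d) ℂ) :
    (vecMulVec ψ (star ψ) * famKron (dims := fun _ : Fin n => d) M).trace = correlation ψ M := by
  simp [Matrix.trace, Matrix.mul_apply, vecMulVec_apply, famKron, correlation]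

section Partition

variable {ι : Type*} [Fintype ι] {m : ℕ} {B : Fin m → Finset ι}

/-- The indices of `ι`, sorted by the block of the partition containing them. -/
noncomputable def partitionEquiv (hdisj : ∀ b b', b ≠ b' → Disjoint (B b) (B b'))
    (hcover : ∀ i, ∃ b, i ∈ B b) : (Σ b, {j // j ∈ B b}) ≃ ι :=
  Equiv.ofBijective (fun s => s.2.1) <| by
    constructor
    · rintro ⟨b, j, hj⟩ ⟨b', j', hj'⟩ (rfl : j = j')
      obtain rfl : b = b' := by
        by_contra h
        exact Finset.disjoint_left.1 (hdisj b b' h) hj hj'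
      rfl
    · intro i
      obtain ⟨b, hb⟩ := hcover i
      exact ⟨⟨b, i, hb⟩, rfl⟩

theorem prod_partition (hdisj : ∀ b b', b ≠ b' → Disjoint (B b) (B b'))
    (hcover : ∀ i, ∃ b, i ∈ B b) {R : Type*} [CommMonoid R] (h : ι → R) :
    ∏ i, h i = ∏ b, ∏ j : {j // j ∈ B b}, h j := by
  rw [← (partitionEquiv hdisj hcover).prod_comp, Fintype.prod_sigma]
  rfl

theorem sum_prod_partition [DecidableEq ι] (hdisj : ∀ b b', b ≠ b' → Disjoint (B b) (B b'))
    (hcover : ∀ i, ∃ b, i ∈ B b) {R D : Type*} [CommSemiring R] [Fintype D]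
    (F : ∀ b, ({j // j ∈ B b} → D) → R) :
    ∑ x : ι → D, ∏ b, F b (fun j => x j) = ∏ b, ∑ y, F b y := by
  rw [Finset.prod_univ_sum, Fintype.piFinset_univ]
  exact Fintype.sum_equiv
    (((partitionEquiv hdisj hcover).symm.arrowCongr (Equiv.refl D)).trans
      (Equiv.piCurry fun _ _ => D)) _ _ fun x => rfl

theorem correlation_partition [DecidableEq ι] (hdisj : ∀ b b', b ≠ b' → Disjoint (B b) (B b'))
    (hcover : ∀ i, ∃ b, i ∈ B b) {D : Type*} [Fintype D]
    (φ : ∀ b, ({j // j ∈ B b} → D) → ℂ) (M : ι → Matrix D D ℂ) :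
    correlation (fun x => ∏ b, φ b fun j => x j) M
      = ∏ b, correlation (φ b) fun j : {j // j ∈ B b} => M j := by
  simp only [correlation]
  rw [← sum_prod_partition hdisj hcover]
  refine Finset.sum_congr rfl fun x _ => ?_
  rw [← sum_prod_partition hdisj hcover fun b y =>
    φ b (fun j => x j) * star (φ b y) * ∏ j : {j // j ∈ B b}, M j (y j) (x j)]
  refine Finset.sum_congr rfl fun y _ => ?_
  rw [prod_partition hdisj hcover, star_prod, ← Finset.prod_mul_distrib,
    ← Finset.prod_mul_distrib]

end Partition

theorem norm_sum_mul_sq_le {N : ℕ} (p : Fin N → ℝ) (hp : ∀ k, 0 < p k) (hp1 : ∑ k, p k = 1)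
    (z : Fin N → ℂ) : ‖∑ k, (p k : ℂ) * z k‖ ^ 2 ≤ ∑ k, p k * ‖z k‖ ^ 2 := by
  have hconv : ConvexOn ℝ Set.univ fun z : ℂ => ‖z‖ ^ 2 :=
    (convexOn_norm convex_univ).pow (fun _ _ => norm_nonneg _) 2
  simpa [Complex.real_smul] using
    hconv.map_sum_le (t := Finset.univ) (w := p) (p := z) (fun k _ => (hp k).le) hp1
      fun _ _ => Set.mem_univ _

/-- For an n-qudit state separable with respect to a partition of the parties into blocks,
the squared norm of the full correlation tensor is bounded by the product over blocks of the
single-block bounds a_{|block|}; for equal block sizes this reads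
‖T^{(12⋯n)}‖² ≤ a₁^p a₂^q ⋯ a_t^s. -/
theorem partition_separable_correlation_bound (n d : ℕ) (hn : 3 ≤ n) (hd : 2 ≤ d)
    (m : ℕ) (B : Fin m → Finset (Fin n))
    (hne : ∀ b, (B b).Nonempty)
    (hdisj : ∀ b b', b ≠ b' → Disjoint (B b) (B b'))
    (hcover : ∀ i, ∃ b, i ∈ B b)
    (ρ : Matrix (Fin n → Fin d) (Fin n → Fin d) ℂ)
    (hsep : ∃ (N : ℕ) (p : Fin N → ℝ)
        (φ : Fin N → ∀ b : Fin m, ({j // j ∈ B b} → Fin d) → ℂ),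
        (∀ k, 0 < p k) ∧ (∑ k, p k = 1) ∧
        (∀ k b, ∑ y, ‖φ k b y‖ ^ 2 = 1) ∧
        ρ = ∑ k, (p k : ℂ) •
          vecMulVec (fun x => ∏ b, φ k b fun j => x j.1)
            (star fun x => ∏ b, φ k b fun j => x j.1))
    (lam : Fin (d ^ 2 - 1) → Matrix (Fin d) (Fin d) ℂ)
    (hherm : ∀ i, (lam i).IsHermitian)
    (htr0 : ∀ i, (lam i).trace = 0)
    (horth : ∀ i j, (lam i * lam j).trace = if i = j then 2 else 0) :
    ∑ i : Fin n → Fin (d ^ 2 - 1),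
        ‖(ρ * famKron (dims := fun _ : Fin n => d) fun k => lam (i k)).trace‖ ^ 2
      ≤ ∏ b, blockBound d (B b).card := by
  obtain ⟨N, p, φ, hp, hp1, hφ, rfl⟩ := hsep
  have hpure : ∀ k, ∑ i : Fin n → Fin (d ^ 2 - 1),
      ‖correlation (fun x => ∏ b, φ k b fun j => x j.1) fun l => lam (i l)‖ ^ 2
        ≤ ∏ b, blockBound d (B b).card := fun k => by
    simp_rw [correlation_partition hdisj hcover (φ k), norm_prod, ← Finset.prod_pow]
    rw [sum_prod_partition hdisj hcover fun b (i : {j // j ∈ B b} → Fin (d ^ 2 - 1)) =>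
      ‖correlation (φ k b) fun j => lam (i j)‖ ^ 2]
    refine Finset.prod_le_prod (fun b _ => Finset.sum_nonneg fun _ _ => sq_nonneg _) fun b _ => ?_
    have : Nonempty {j // j ∈ B b} := (hne b).to_subtype
    simpa using sum_norm_sq_correlation_le_blockBound (by omega) lam hherm htr0 horth (φ k b)
      (hφ k b)
  simp_rw [Finset.sum_mul, Matrix.trace_sum, Matrix.smul_mul, Matrix.trace_smul, smul_eq_mul,
    trace_vecMulVec_mul_famKron]
  calc _ ≤ ∑ i : Fin n → Fin (d ^ 2 - 1), ∑ k, p k *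
        ‖correlation (fun x => ∏ b, φ k b fun j => x j.1) fun l => lam (i l)‖ ^ 2 :=
        Finset.sum_le_sum fun i _ => norm_sum_mul_sq_le p hp hp1 _
    _ = ∑ k, p k * ∑ i : Fin n → Fin (d ^ 2 - 1),
        ‖correlation (fun x => ∏ b, φ k b fun j => x j.1) fun l => lam (i l)‖ ^ 2 := by
        rw [Finset.sum_comm]
        simp_rw [Finset.mul_sum]
    _ ≤ ∑ k, p k * ∏ b, blockBound d (B b).card :=
        Finset.sum_le_sum fun k _ => mul_le_mul_of_nonneg_left (hpure k) (hp k).le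
    _ = _ := by rw [← Finset.sum_mul, hp1, one_mul]
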